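/- For real numbers a, b, c with ab ≠ 0 let 𝒜(a,b,c) be the 8×8 real matrix with rows: row 1 = (a⁵b, a⁵bc, 0,0,0,0,0,0); row 2 = (0, a⁴b, 0,0,0,0,0,0); row 3 = (2a⁶bc, a⁶bc², a⁶b, 0,0,0,0,0); row 4 = (0,0,0, a³b, a³bc, 0,0,0); row 5 = (0,0,0, 0, a²b, 0,0,0); row 6 = (0,0,0, a³(1−b), a³(1−b)c, a³, a³c, 0); row 7 = (0,0,0, 0, a²(1−b), 0, a², 0); row 8 = (0,0,0,0,0,0,0, b). Then each 𝒜(a,b,c) is invertible, 𝒜(1,1,0) is the identity, and 𝒜(a,b,c)·𝒜(a′,b′,c′) = 𝒜(aa′, bb′, c′ + c/a′); consequently the set H = {𝒜(a,b,c) : a,b,c ∈ ℝ, ab ≠ 0} is a subgroup of GL(8,ℝ). -/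

import Mathlib

open Matrix

noncomputable section

/-- The matrix `𝒜(a,b,c)` of the reduced structure group `H` (Theorem 4.3, eq. (4.8)). -/
def calA (a b c : ℝ) : Matrix (Fin 8) (Fin 8) ℝ :=
  !![a^5*b, a^5*b*c, 0, 0, 0, 0, 0, 0;
     0, a^4*b, 0, 0, 0, 0, 0, 0;
     2*a^6*b*c, a^6*b*c^2, a^6*b, 0, 0, 0, 0, 0;
     0, 0, 0, a^3*b, a^3*b*c, 0, 0, 0;
     0, 0, 0, 0, a^2*b, 0, 0, 0;
     0, 0, 0, a^3*(1-b), a^3*(1-b)*c, a^3, a^3*c, 0;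
     0, 0, 0, 0, a^2*(1-b), 0, a^2, 0;
     0, 0, 0, 0, 0, 0, 0, b]

theorem calA_one : calA 1 1 0 = 1 := by
  ext i j
  fin_cases i <;> fin_cases j <;> simp [calA]

theorem calA_mul (a b c a' b' c' : ℝ) (h' : a' * b' ≠ 0) :
    calA a b c * calA a' b' c' = calA (a * a') (b * b') (c' + c / a') := by
  have ha : a' ≠ 0 := left_ne_zero_of_mul h'
  obtain ⟨d, rfl⟩ : ∃ d, c = d * a' := ⟨c / a', by field_simp⟩
  rw [mul_div_cancel_right₀ _ ha]
  ext i j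
  fin_cases i <;> fin_cases j <;> simp [calA, Matrix.mul_apply, Fin.sum_univ_succ] <;> ring

theorem calA_inv_ne {a b : ℝ} (h : a * b ≠ 0) : a⁻¹ * b⁻¹ ≠ 0 := by
  rw [← mul_inv]
  exact inv_ne_zero h

theorem calA_mul_inv (a b c : ℝ) (h : a * b ≠ 0) :
    calA a b c * calA a⁻¹ b⁻¹ (-(c * a)) = 1 := by
  have ha : a ≠ 0 := left_ne_zero_of_mul h
  have hb : b ≠ 0 := right_ne_zero_of_mul h
  rw [calA_mul _ _ _ _ _ _ (calA_inv_ne h), mul_inv_cancel₀ ha, mul_inv_cancel₀ hb,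
    div_inv_eq_mul, neg_add_cancel, calA_one]

theorem calA_isUnit (a b c : ℝ) (h : a * b ≠ 0) : IsUnit (calA a b c) :=
  IsUnit.of_mul_eq_one _ (calA_mul_inv a b c h)

/-- The subgroup `H`. -/
def calH : Subgroup (Matrix.GeneralLinearGroup (Fin 8) ℝ) where
  carrier := {M | ∃ a b c : ℝ, a * b ≠ 0 ∧ (M : Matrix (Fin 8) (Fin 8) ℝ) = calA a b c}
  one_mem' := ⟨1, 1, 0, by norm_num, by rw [calA_one]; rfl⟩
  mul_mem' := by
    rintro M N ⟨a, b, c, h, hM⟩ ⟨a', b', c', h', hN⟩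
    refine ⟨a * a', b * b', c' + c / a', ?_, ?_⟩
    · rw [mul_mul_mul_comm]
      exact mul_ne_zero h h'
    · rw [Units.val_mul, hM, hN, calA_mul _ _ _ _ _ _ h']
  inv_mem' := by
    rintro M ⟨a, b, c, h, hM⟩
    refine ⟨a⁻¹, b⁻¹, -(c * a), calA_inv_ne h, ?_⟩
    apply Units.inv_eq_of_mul_eq_one_right
    rw [hM, calA_mul_inv a b c h]

/-- Each `𝒜(a,b,c)` with `ab ≠ 0` is invertible, `𝒜(1,1,0) = 1`, multiplication obeys
`𝒜(a,b,c)·𝒜(a′,b′,c′) = 𝒜(aa′, bb′, c′ + c/a′)`, and the set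
`H = {𝒜(a,b,c) : ab ≠ 0}` is a subgroup of `GL(8,ℝ)`. -/
theorem calA_group :
    (∀ a b c : ℝ, a * b ≠ 0 → IsUnit (calA a b c)) ∧
    calA 1 1 0 = 1 ∧
    (∀ a b c a' b' c' : ℝ, a * b ≠ 0 → a' * b' ≠ 0 →
      calA a b c * calA a' b' c' = calA (a * a') (b * b') (c' + c / a')) ∧
    (∃ H : Subgroup (Matrix.GeneralLinearGroup (Fin 8) ℝ),
      (fun M : Matrix.GeneralLinearGroup (Fin 8) ℝ => (M : Matrix (Fin 8) (Fin 8) ℝ)) ''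
          (H : Set (Matrix.GeneralLinearGroup (Fin 8) ℝ))
        = {M : Matrix (Fin 8) (Fin 8) ℝ | ∃ a b c : ℝ, a * b ≠ 0 ∧ M = calA a b c}) := by
  refine ⟨calA_isUnit, calA_one, fun a b c a' b' c' _ h' => calA_mul a b c a' b' c' h', calH, ?_⟩
  ext M
  constructor
  · rintro ⟨N, ⟨a, b, c, h, hN⟩, rfl⟩
    exact ⟨a, b, c, h, hN⟩
  · rintro ⟨a, b, c, h, rfl⟩
    exact ⟨(calA_isUnit a b c h).unit, ⟨a, b, c, h, rfl⟩, rfl⟩
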